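/- Over the field GF(2) with two elements, there are exactly 35 invertible 3×3 matrices that cannot be written as a product of at most three invertible matrices each differing from the 3×3 identity matrix in at most one row. (Every invertible 3×3 matrix over GF(2) is a product of at most four such matrices.) -/

import Mathlib

open Matrix

/-- A linear instruction: an `n × n` matrix over `F` that differs from the identity
matrix in at most one row. -/
def Matrix.IsLinearInstruction {F : Type*} [Semiring F] {n : ℕ}
    (M : Matrix (Fin n) (Fin n) F) : Prop :=
  ∃ i : Fin n, ∀ j : Fin n, j ≠ i → M j = (1 : Matrix (Fin n) (Fin n) F) j

/-- `M` is a product of at most `k` bijective linear instructions over `GF(2)`. -/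
def IsInstructionProduct (k : ℕ) (M : Matrix (Fin 3) (Fin 3) (ZMod 2)) : Prop :=
  ∃ L : List (Matrix (Fin 3) (Fin 3) (ZMod 2)),
    L.length ≤ k ∧ (∀ A ∈ L, IsUnit A ∧ A.IsLinearInstruction) ∧ L.prod = M

/-- The vector of the three lowest binary digits of `a`. -/
def bitRow (a : ℕ) : Fin 3 → ZMod 2 := fun j => if a.testBit j then 1 else 0

/-- The matrix whose rows are given by the binary digits of `a`, `b` and `c`. -/
def bitMatrix (a b c : ℕ) : Matrix (Fin 3) (Fin 3) (ZMod 2) :=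
  of ![bitRow a, bitRow b, bitRow c]

/-- Whether some bijective linear instruction takes the rows `a`, `b`, `c` into `f`. -/
def someNeighbor (f : ℕ → ℕ → ℕ → Bool) (a b c : ℕ) : Bool :=
  f a b c ||
    (f (Nat.xor a b) b c || (f (Nat.xor a c) b c || (f (Nat.xor a (Nat.xor b c)) b c ||
    (f a (Nat.xor b a) c || (f a (Nat.xor b c) c || (f a (Nat.xor b (Nat.xor a c)) c ||
    (f a b (Nat.xor c a) || (f a b (Nat.xor c b) || f a b (Nat.xor c (Nat.xor a b))))))))))

/-- Whether the rows `a`, `b`, `c` become those of the identity after at most `k` instructions. -/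
def reducesIn : ℕ → ℕ → ℕ → ℕ → Bool
  | 0 => fun a b c => Nat.beq a 1 && (Nat.beq b 2 && Nat.beq c 4)
  | k + 1 => someNeighbor (reducesIn k)

/-- Whether no nontrivial combination of `a`, `b`, `c` vanishes. -/
def independentBits (a b c : ℕ) : Bool :=
  !(Nat.beq a 0 || (Nat.beq b 0 || (Nat.beq c 0 || (Nat.beq (Nat.xor a b) 0 ||
    (Nat.beq (Nat.xor a c) 0 || (Nat.beq (Nat.xor b c) 0 ||
    Nat.beq (Nat.xor a (Nat.xor b c)) 0))))))

theorem bitRow_zero : bitRow 0 = 0 := by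
  ext j; simp [bitRow]

theorem bitRow_xor (a b : ℕ) : bitRow (Nat.xor a b) = bitRow a + bitRow b := by
  change bitRow (a ^^^ b) = _
  ext j
  simp only [bitRow, Nat.testBit_xor, Pi.add_apply]
  cases a.testBit j <;> cases b.testBit j <;> decide

theorem bitRow_injOn : Set.InjOn bitRow {a | a < 8} := by
  intro a ha b hb h
  have key : ∀ a < 8, ∀ b < 8, bitRow a = bitRow b → a = b := by decide
  exact key a ha b hb h

theorem exists_bitRow_eq (v : Fin 3 → ZMod 2) : ∃ a < 8, bitRow a = v := by
  revert v; decide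

theorem exists_bitMatrix_eq (M : Matrix (Fin 3) (Fin 3) (ZMod 2)) :
    ∃ a < 8, ∃ b < 8, ∃ c < 8, bitMatrix a b c = M := by
  obtain ⟨a, ha, ha'⟩ := exists_bitRow_eq (M 0)
  obtain ⟨b, hb, hb'⟩ := exists_bitRow_eq (M 1)
  obtain ⟨c, hc, hc'⟩ := exists_bitRow_eq (M 2)
  refine ⟨a, ha, b, hb, c, hc, ?_⟩
  ext i j
  fin_cases i <;> simp [bitMatrix, ha', hb', hc']

theorem bitMatrix_inj {a b c a' b' c' : ℕ} (ha : a < 8) (hb : b < 8) (hc : c < 8)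
    (ha' : a' < 8) (hb' : b' < 8) (hc' : c' < 8) (h : bitMatrix a b c = bitMatrix a' b' c') :
    a = a' ∧ b = b' ∧ c = c' :=
  ⟨bitRow_injOn ha ha' (congrFun h 0), bitRow_injOn hb hb' (congrFun h 1),
    bitRow_injOn hc hc' (congrFun h 2)⟩

theorem bitMatrix_one_two_four : bitMatrix 1 2 4 = 1 := by decide

theorem bijective_instruction_iff (A : Matrix (Fin 3) (Fin 3) (ZMod 2)) :
    IsUnit A ∧ A.IsLinearInstruction ↔ ∃ s t : ZMod 2,
      A = !![1, s, t; 0, 1, 0; 0, 0, 1] ∨ A = !![1, 0, 0; s, 1, t; 0, 0, 1] ∨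
        A = !![1, 0, 0; 0, 1, 0; s, t, 1] := by
  have eq_one : ∀ x : ZMod 2, x ≠ 0 → x = 1 := by decide
  rw [isUnit_iff_isUnit_det, isUnit_iff_ne_zero, det_fin_three]
  constructor
  · rintro ⟨hA, i, hi⟩
    fin_cases i
    · have h1 := hi 1 (by decide)
      have h2 := hi 2 (by decide)
      simp [h1, h2] at hA
      refine ⟨A 0 1, A 0 2, Or.inl ?_⟩
      ext i j
      fin_cases i <;> fin_cases j <;> simp [h1, h2, eq_one _ hA]
    · have h1 := hi 0 (by decide)
      have h2 := hi 2 (by decide)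
      simp [h1, h2] at hA
      refine ⟨A 1 0, A 1 2, Or.inr (Or.inl ?_)⟩
      ext i j
      fin_cases i <;> fin_cases j <;> simp [h1, h2, eq_one _ hA]
    · have h1 := hi 0 (by decide)
      have h2 := hi 1 (by decide)
      simp [h1, h2] at hA
      refine ⟨A 2 0, A 2 1, Or.inr (Or.inr ?_)⟩
      ext i j
      fin_cases i <;> fin_cases j <;> simp [h1, h2, eq_one _ hA]
  · rintro ⟨s, t, rfl | rfl | rfl⟩
    · refine ⟨by simp, 0, fun i hi => ?_⟩
      ext j
      fin_cases i <;> fin_cases j <;> simp_all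
    · refine ⟨by simp, 1, fun i hi => ?_⟩
      ext j
      fin_cases i <;> fin_cases j <;> simp_all
    · refine ⟨by simp, 2, fun i hi => ?_⟩
      ext j
      fin_cases i <;> fin_cases j <;> simp_all

theorem bijective_instruction_mul_self {A : Matrix (Fin 3) (Fin 3) (ZMod 2)}
    (hA : IsUnit A ∧ A.IsLinearInstruction) : A * A = 1 := by
  obtain ⟨s, t, h⟩ := (bijective_instruction_iff A).1 hA
  clear hA
  rcases h with rfl | rfl | rfl <;> revert s t <;> decide

theorem isInstructionProduct_zero (M : Matrix (Fin 3) (Fin 3) (ZMod 2)) :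
    IsInstructionProduct 0 M ↔ M = 1 := by
  constructor
  · rintro ⟨L, hL, -, rfl⟩
    simp [List.length_eq_zero_iff.1 (Nat.le_zero.1 hL)]
  · rintro rfl
    exact ⟨[], by simp⟩

theorem isInstructionProduct_succ (k : ℕ) (M : Matrix (Fin 3) (Fin 3) (ZMod 2)) :
    IsInstructionProduct (k + 1) M ↔
      ∃ A, (IsUnit A ∧ A.IsLinearInstruction) ∧ IsInstructionProduct k (A * M) := by
  constructor
  · rintro ⟨_ | ⟨A, L⟩, hL, hA, rfl⟩
    · exact ⟨1, ⟨isUnit_one, 0, fun _ _ => rfl⟩, [], by simp⟩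
    · have hA' := hA A (by simp)
      refine ⟨A, hA', L, by simpa using hL, fun B hB => hA B (by simp [hB]), ?_⟩
      rw [List.prod_cons, ← mul_assoc, bijective_instruction_mul_self hA', one_mul]
  · rintro ⟨A, hA, L, hL, hL', hM⟩
    refine ⟨A :: L, by simpa using hL, ?_, ?_⟩
    · simpa only [List.forall_mem_cons] using ⟨hA, hL'⟩
    · rw [List.prod_cons, hM, ← mul_assoc, bijective_instruction_mul_self hA, one_mul]

theorem someNeighbor_iff (f : ℕ → ℕ → ℕ → Bool) (P : Matrix (Fin 3) (Fin 3) (ZMod 2) → Prop)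
    (hf : ∀ a < 8, ∀ b < 8, ∀ c < 8, P (bitMatrix a b c) ↔ f a b c = true)
    {a b c : ℕ} (ha : a < 8) (hb : b < 8) (hc : c < 8) :
    (∃ A, (IsUnit A ∧ A.IsLinearInstruction) ∧ P (A * bitMatrix a b c)) ↔
      someNeighbor f a b c = true := by
  have upper (s t : ZMod 2) : !![1, s, t; 0, 1, 0; 0, 0, 1] * bitMatrix a b c =
      of ![bitRow a + (s • bitRow b + t • bitRow c), bitRow b, bitRow c] := by
    ext i j
    fin_cases i <;> simp [bitMatrix, mul_apply, Fin.sum_univ_three, add_assoc]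
  have middle (s t : ZMod 2) : !![1, 0, 0; s, 1, t; 0, 0, 1] * bitMatrix a b c =
      of ![bitRow a, bitRow b + (s • bitRow a + t • bitRow c), bitRow c] := by
    ext i j
    fin_cases i <;> simp [bitMatrix, mul_apply, Fin.sum_univ_three]
    ring
  have lower (s t : ZMod 2) : !![1, 0, 0; 0, 1, 0; s, t, 1] * bitMatrix a b c =
      of ![bitRow a, bitRow b, bitRow c + (s • bitRow a + t • bitRow b)] := by
    ext i j
    fin_cases i <;> simp [bitMatrix, mul_apply, Fin.sum_univ_three]
    ring
  have exists_bit (Q : ZMod 2 → Prop) : (∃ s, Q s) ↔ Q 0 ∨ Q 1 := Fin.exists_fin_two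
  simp only [bijective_instruction_iff, exists_bit, or_and_right, exists_or, exists_eq_left,
    upper, middle, lower, zero_smul, one_smul, zero_add, add_zero]
  have xor_lt {x y : ℕ} (hx : x < 8) (hy : y < 8) : Nat.xor x y < 8 :=
    Nat.xor_lt_two_pow (n := 3) hx hy
  have hf' {x y z : ℕ} (hx : x < 8) (hy : y < 8) (hz : z < 8) :
      f x y z = true ↔ P (bitMatrix x y z) := (hf x hx y hy z hz).symm
  simp only [someNeighbor, Bool.or_eq_true, hf', xor_lt, xor_lt ha (xor_lt hb hc),
    xor_lt hb (xor_lt ha hc), xor_lt hc (xor_lt ha hb), ha, hb, hc]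
  simp only [bitMatrix, bitRow_xor]
  clear hf hf'
  grind

theorem isInstructionProduct_bitMatrix_iff (k : ℕ) {a b c : ℕ} (ha : a < 8) (hb : b < 8)
    (hc : c < 8) : IsInstructionProduct k (bitMatrix a b c) ↔ reducesIn k a b c = true := by
  induction k generalizing a b c with
  | zero =>
    rw [isInstructionProduct_zero, ← bitMatrix_one_two_four]
    simp only [reducesIn, Bool.and_eq_true, Nat.beq_eq]
    constructor
    · exact bitMatrix_inj ha hb hc (by decide) (by decide) (by decide)
    · rintro ⟨rfl, rfl, rfl⟩
      rfl
  | succ k ih =>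
    rw [isInstructionProduct_succ]
    exact someNeighbor_iff _ _ (fun _ ha _ hb _ hc => ih ha hb hc) ha hb hc

theorem reducesIn_four_of_independentBits :
    ∀ a < 8, ∀ b < 8, ∀ c < 8, independentBits a b c = true → reducesIn 4 a b c = true := by
  decide +kernel

theorem independentBits_of_isUnit {a b c : ℕ} (h : IsUnit (bitMatrix a b c)) :
    independentBits a b c = true := by
  have comb (v : Fin 3 → ZMod 2) (hv : v ≠ 0) :
      v 0 • bitRow a + v 1 • bitRow b + v 2 • bitRow c ≠ 0 := by
    intro h0
    apply hv
    apply vecMul_injective_of_isUnit h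
    change v ᵥ* bitMatrix a b c = 0 ᵥ* bitMatrix a b c
    rw [zero_vecMul, ← h0]
    ext j
    simp [bitMatrix, vecMul, dotProduct, Fin.sum_univ_three]
  have ne_zero {x : ℕ} (hx : bitRow x ≠ 0) : x ≠ 0 := by
    rintro rfl
    exact hx bitRow_zero
  rw [independentBits, Bool.not_eq_true', ← Bool.not_eq_true]
  simp only [Bool.or_eq_true, Nat.beq_eq, not_or]
  refine ⟨ne_zero ?_, ne_zero ?_, ne_zero ?_, ne_zero ?_, ne_zero ?_, ne_zero ?_, ne_zero ?_⟩
  · simpa using comb ![1, 0, 0] (by decide)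
  · simpa using comb ![0, 1, 0] (by decide)
  · simpa using comb ![0, 0, 1] (by decide)
  · rw [bitRow_xor]
    simpa using comb ![1, 1, 0] (by decide)
  · rw [bitRow_xor]
    simpa using comb ![1, 0, 1] (by decide)
  · rw [bitRow_xor]
    simpa using comb ![0, 1, 1] (by decide)
  · rw [bitRow_xor, bitRow_xor]
    simpa [add_assoc] using comb ![1, 1, 1] (by decide)

theorem isUnit_of_isInstructionProduct {k : ℕ} {M : Matrix (Fin 3) (Fin 3) (ZMod 2)}
    (h : IsInstructionProduct k M) : IsUnit M := by
  obtain ⟨L, -, hL, rfl⟩ := h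
  exact L.prod_isUnit fun A hA => (hL A hA).1

theorem isInstructionProduct_four_of_isUnit {M : Matrix (Fin 3) (Fin 3) (ZMod 2)}
    (hM : IsUnit M) : IsInstructionProduct 4 M := by
  obtain ⟨a, ha, b, hb, c, hc, rfl⟩ := exists_bitMatrix_eq M
  exact (isInstructionProduct_bitMatrix_iff 4 ha hb hc).2
    (reducesIn_four_of_independentBits a ha b hb c hc (independentBits_of_isUnit hM))

theorem isUnit_bitMatrix_iff {a b c : ℕ} (ha : a < 8) (hb : b < 8) (hc : c < 8) :
    IsUnit (bitMatrix a b c) ↔ independentBits a b c = true :=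
  ⟨independentBits_of_isUnit, fun h => isUnit_of_isInstructionProduct
    ((isInstructionProduct_bitMatrix_iff 4 ha hb hc).2
      (reducesIn_four_of_independentBits a ha b hb c hc h))⟩

/-- The codes of the invertible matrices that are not products of three instructions. -/
def extremalCodes : Finset (ℕ × ℕ × ℕ) :=
  (Finset.range 8 ×ˢ Finset.range 8 ×ˢ Finset.range 8).filter fun p =>
    (independentBits p.1 p.2.1 p.2.2 && !reducesIn 3 p.1 p.2.1 p.2.2) = true

theorem card_extremalCodes : extremalCodes.card = 35 := by
  decide +kernel

theorem mem_extremalCodes {a b c : ℕ} : (a, b, c) ∈ extremalCodes ↔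
    (a < 8 ∧ b < 8 ∧ c < 8) ∧ independentBits a b c = true ∧ ¬ reducesIn 3 a b c = true := by
  simp [extremalCodes]

theorem setOf_extremal_eq_image :
    {M : Matrix (Fin 3) (Fin 3) (ZMod 2) | IsUnit M ∧ ¬ IsInstructionProduct 3 M} =
      (fun p : ℕ × ℕ × ℕ => bitMatrix p.1 p.2.1 p.2.2) '' extremalCodes := by
  ext M
  constructor
  · rintro ⟨hM, hM'⟩
    obtain ⟨a, ha, b, hb, c, hc, rfl⟩ := exists_bitMatrix_eq M
    rw [isInstructionProduct_bitMatrix_iff 3 ha hb hc] at hM'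
    exact ⟨(a, b, c), mem_extremalCodes.2
      ⟨⟨ha, hb, hc⟩, independentBits_of_isUnit hM, hM'⟩, rfl⟩
  · rintro ⟨⟨a, b, c⟩, hp, rfl⟩
    obtain ⟨⟨ha, hb, hc⟩, h1, h2⟩ := mem_extremalCodes.1 hp
    exact ⟨(isUnit_bitMatrix_iff ha hb hc).2 h1,
      fun h => h2 ((isInstructionProduct_bitMatrix_iff 3 ha hb hc).1 h)⟩

/-- Over `GF(2)`, exactly `35` invertible `3 × 3` matrices are not a product of at most
three bijective linear instructions; every invertible `3 × 3` matrix is a product of at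
most four. -/
theorem GL3_GF2_thirty_five_extremal_matrices :
    ({M : Matrix (Fin 3) (Fin 3) (ZMod 2) | IsUnit M ∧
        ¬ ∃ L : List (Matrix (Fin 3) (Fin 3) (ZMod 2)),
          L.length ≤ 3 ∧ (∀ A ∈ L, IsUnit A ∧ A.IsLinearInstruction) ∧
          L.prod = M}).ncard = 35 ∧
    ∀ M : Matrix (Fin 3) (Fin 3) (ZMod 2), IsUnit M →
      ∃ L : List (Matrix (Fin 3) (Fin 3) (ZMod 2)),
        L.length ≤ 4 ∧ (∀ A ∈ L, IsUnit A ∧ A.IsLinearInstruction) ∧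
        L.prod = M := by
  refine ⟨?_, fun M hM => isInstructionProduct_four_of_isUnit hM⟩
  change Set.ncard {M | IsUnit M ∧ ¬ IsInstructionProduct 3 M} = 35
  rw [setOf_extremal_eq_image, Set.InjOn.ncard_image, Set.ncard_coe_finset,
    card_extremalCodes]
  rintro ⟨a, b, c⟩ hp ⟨a', b', c'⟩ hp' h
  obtain ⟨⟨ha, hb, hc⟩, -⟩ := mem_extremalCodes.1 hp
  obtain ⟨⟨ha', hb', hc'⟩, -⟩ := mem_extremalCodes.1 hp'
  obtain ⟨rfl, rfl, rfl⟩ := bitMatrix_inj ha hb hc ha' hb' hc' h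
  rfl
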